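/- Let G be a finite group, p a prime, and N a normal subgroup of G. Then m_p(G) equals the maximum, over all elementary abelian p-subgroups A of G (the trivial subgroup allowed) satisfying A ∩ N = 1, of m_p(C_N(A)) + log_p|A|, where C_N(A) denotes the centralizer of A in N. -/

import Mathlib

/-- A subgroup `E` of a group is an elementary abelian `p`-subgroup if it is
commutative and every element `x ∈ E` satisfies `x ^ p = 1`. -/
def IsElemAbelian {G : Type*} [Group G] (p : ℕ) (E : Subgroup G) : Prop :=
  (∀ x ∈ E, ∀ y ∈ E, x * y = y * x) ∧ ∀ x ∈ E, x ^ p = 1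

/-- The `p`-rank `m_p(G)`: the largest `k` such that `G` has an elementary abelian
`p`-subgroup of order `p ^ k`. -/
noncomputable def pRank (p : ℕ) (G : Type*) [Group G] : ℕ :=
  sSup {k : ℕ | ∃ E : Subgroup G, IsElemAbelian p E ∧ Nat.card E = p ^ k}

namespace IsElemAbelian

variable {G : Type*} [Group G] {p : ℕ} {A B E : Subgroup G}

theorem mono (hE : IsElemAbelian p E) (h : A ≤ E) : IsElemAbelian p A :=
  ⟨fun x hx y hy => hE.1 x (h hx) y (h hy), fun x hx => hE.2 x (h hx)⟩

theorem map {K : Type*} [Group K] (f : G →* K) (hE : IsElemAbelian p E) :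
    IsElemAbelian p (E.map f) := by
  constructor
  · rintro _ ⟨x, hx, rfl⟩ _ ⟨y, hy, rfl⟩
    rw [← map_mul, hE.1 x hx y hy, map_mul]
  · rintro _ ⟨x, hx, rfl⟩
    rw [← map_pow, hE.2 x hx, map_one]

theorem subgroupOf (hE : IsElemAbelian p E) (H : Subgroup G) :
    IsElemAbelian p (E.subgroupOf H) :=
  ⟨fun x hx y hy => Subtype.ext (hE.1 x hx y hy), fun x hx => Subtype.ext (hE.2 x hx)⟩

/-- The join of two commuting elementary abelian subgroups is elementary abelian. -/
theorem sup (hA : IsElemAbelian p A) (hB : IsElemAbelian p B)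
    (hAB : ∀ a ∈ A, ∀ b ∈ B, Commute a b) : IsElemAbelian p (A ⊔ B) := by
  have hc : ∀ (a : A) (b : B), Commute (A.subtype a) (B.subtype b) :=
    fun a b => hAB a a.2 b b.2
  have hr : A ⊔ B = (MonoidHom.noncommCoprod A.subtype B.subtype hc).range := by
    rw [MonoidHom.noncommCoprod_range, Subgroup.range_subtype, Subgroup.range_subtype]
  have hA' : ∀ a a' : A, a * a' = a' * a := fun a a' => Subtype.ext (hA.1 a a.2 a' a'.2)
  have hB' : ∀ b b' : B, b * b' = b' * b := fun b b' => Subtype.ext (hB.1 b b.2 b' b'.2)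
  rw [hr]
  constructor
  · rintro _ ⟨x, rfl⟩ _ ⟨y, rfl⟩
    rw [← map_mul, ← map_mul]
    exact congrArg _ (Prod.ext (hA' _ _) (hB' _ _))
  · rintro _ ⟨x, rfl⟩
    rw [← map_pow]
    have : x ^ p = 1 := Prod.ext (Subtype.ext (hA.2 x.1 x.1.2)) (Subtype.ext (hB.2 x.2 x.2.2))
    rw [this, map_one]

/-- Every subgroup of an elementary abelian `p`-group has a complement. -/
theorem exists_complement (hp : p.Prime) (hE : IsElemAbelian p E) (hB : B ≤ E) :
    ∃ A ≤ E, Disjoint A B ∧ A ⊔ B = E := by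
  have : Fact p.Prime := ⟨hp⟩
  let : CommGroup E := { (inferInstance : Group E) with
    mul_comm := fun x y => Subtype.ext (hE.1 x x.2 y y.2) }
  let : Module (ZMod p) (Additive E) := AddCommGroup.zmodModule (n := p) fun x =>
    congrArg Additive.ofMul (Subtype.ext (hE.2 x.toMul x.toMul.2) : x.toMul ^ p = 1)
  let e : Subgroup E ≃o Submodule (ZMod p) (Additive E) :=
    Subgroup.toAddSubgroup.trans (AddSubgroup.toZModSubmodule p)
  have : ComplementedLattice (Subgroup E) := e.symm.complementedLattice
  obtain ⟨C, hC⟩ := exists_isCompl (B.subgroupOf E)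
  have hBE : (B.subgroupOf E).map E.subtype = B := Subgroup.map_subgroupOf_eq_of_le hB
  refine ⟨C.map E.subtype, Subgroup.map_subtype_le C, ?_, ?_⟩
  · rw [disjoint_iff, ← hBE, ← Subgroup.map_inf _ _ _ E.subtype_injective, inf_comm,
      hC.inf_eq_bot, Subgroup.map_bot]
  · rw [← hBE, ← Subgroup.map_sup, sup_comm, hC.sup_eq_top, ← MonoidHom.range_eq_map,
      Subgroup.range_subtype]

end IsElemAbelian

/-- The join of two disjoint commuting subgroups has order the product of their orders. -/
theorem Subgroup.card_sup_of_disjoint_of_commute {G : Type*} [Group G] {A B : Subgroup G}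
    (hAB : ∀ a ∈ A, ∀ b ∈ B, Commute a b) (hd : Disjoint A B) :
    Nat.card ↥(A ⊔ B) = Nat.card A * Nat.card B := by
  have hc : ∀ (a : A) (b : B), Commute (A.subtype a) (B.subtype b) :=
    fun a b => hAB a a.2 b b.2
  have hr : A ⊔ B = (MonoidHom.noncommCoprod A.subtype B.subtype hc).range := by
    rw [MonoidHom.noncommCoprod_range, Subgroup.range_subtype, Subgroup.range_subtype]
  have hinj : Function.Injective (MonoidHom.noncommCoprod A.subtype B.subtype hc) := by
    rw [MonoidHom.noncommCoprod_injective]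
    exact ⟨A.subtype_injective, B.subtype_injective, by simpa using hd⟩
  rw [hr, ← Nat.card_prod]
  exact (Nat.card_congr (MonoidHom.ofInjective hinj).toEquiv).symm

section PRank

variable {G : Type*} [Group G] [Finite G] {p : ℕ}

theorem bddAbove_elemAbelian_rank (hp : p.Prime) (G : Type*) [Group G] [Finite G] :
    BddAbove {k : ℕ | ∃ E : Subgroup G, IsElemAbelian p E ∧ Nat.card E = p ^ k} := by
  refine ⟨Nat.card G, ?_⟩
  rintro k ⟨E, -, hk⟩
  exact (Nat.lt_pow_self hp.one_lt).le.trans (hk ▸ E.card_le_card_group)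

theorem IsElemAbelian.le_pRank (hp : p.Prime) {E : Subgroup G} (hE : IsElemAbelian p E) {k : ℕ}
    (hk : Nat.card E = p ^ k) : k ≤ pRank p G :=
  le_csSup (bddAbove_elemAbelian_rank hp G) ⟨E, hE, hk⟩

theorem IsElemAbelian.le_pRank_of_le (hp : p.Prime) {E H : Subgroup G} (hE : IsElemAbelian p E)
    (hEH : E ≤ H) {k : ℕ} (hk : Nat.card E = p ^ k) : k ≤ pRank p H :=
  (hE.subgroupOf H).le_pRank hp <| by
    rw [← hk]; exact Nat.card_congr (Subgroup.subgroupOfEquivOfLe hEH).toEquiv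

theorem exists_isElemAbelian_card_eq_pow_pRank (hp : p.Prime) (G : Type*) [Group G] [Finite G] :
    ∃ E : Subgroup G, IsElemAbelian p E ∧ Nat.card E = p ^ pRank p G := by
  have hbot : IsElemAbelian p (⊥ : Subgroup G) := by simp [IsElemAbelian]
  exact Nat.sSup_mem (s := {k | ∃ E : Subgroup G, IsElemAbelian p E ∧ Nat.card E = p ^ k})
    ⟨0, ⊥, hbot, by simp⟩ (bddAbove_elemAbelian_rank hp G)

theorem exists_isElemAbelian_le_card_eq_pow_pRank (hp : p.Prime) (H : Subgroup G) :
    ∃ E ≤ H, IsElemAbelian p E ∧ Nat.card E = p ^ pRank p H := by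
  obtain ⟨E, hE, hk⟩ := exists_isElemAbelian_card_eq_pow_pRank hp H
  exact ⟨E.map H.subtype, Subgroup.map_subtype_le E, hE.map _,
    (Subgroup.card_map_of_injective H.subtype_injective).trans hk⟩

end PRank

/-- Lemma 4.1 of the paper as an equality: for `N ⊴ G` finite,
`m_p(G) = max { m_p(C_N(A)) + log_p |A| }`, the maximum being taken over all
elementary abelian `p`-subgroups `A ≤ G` (possibly trivial) with `A ∩ N = 1`. -/
theorem stmt_5 {G : Type*} [Group G] [Fintype G] (p : ℕ) (hp : p.Prime)
    (N : Subgroup G) (hN : N.Normal) :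
    pRank p G = sSup {m : ℕ | ∃ A : Subgroup G, IsElemAbelian p A ∧ A ⊓ N = ⊥ ∧
      ∃ j : ℕ, Nat.card A = p ^ j ∧
        m = pRank p ↥(N ⊓ Subgroup.centralizer (A : Set G)) + j} := by
  have hbound : ∀ m ∈ {m : ℕ | ∃ A : Subgroup G, IsElemAbelian p A ∧ A ⊓ N = ⊥ ∧
      ∃ j : ℕ, Nat.card A = p ^ j ∧
        m = pRank p ↥(N ⊓ Subgroup.centralizer (A : Set G)) + j}, m ≤ pRank p G := by
    rintro _ ⟨A, hA, hAN, j, hj, rfl⟩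
    obtain ⟨C, hC, hCe, hk⟩ :=
      exists_isElemAbelian_le_card_eq_pow_pRank hp (N ⊓ Subgroup.centralizer (A : Set G))
    have hcomm : ∀ c ∈ C, ∀ a ∈ A, Commute c a := fun c hc a ha =>
      (Subgroup.mem_centralizer_iff.1 (hC hc).2 a ha).symm
    have hd : Disjoint C A :=
      (disjoint_iff.2 hAN).symm.mono_left (hC.trans inf_le_left)
    refine (hCe.sup hA hcomm).le_pRank hp ?_
    rw [Subgroup.card_sup_of_disjoint_of_commute hcomm hd, hk, hj, pow_add]
  obtain ⟨E, hE, hk⟩ := exists_isElemAbelian_card_eq_pow_pRank hp G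
  obtain ⟨A, hAE, hd, hsup⟩ := hE.exists_complement hp (inf_le_left : E ⊓ N ≤ E)
  have hA := hE.mono hAE
  have hAN : A ⊓ N = ⊥ := by
    rw [← inf_eq_left.2 hAE, inf_assoc, hd.eq_bot]
  have hcard : Nat.card A * Nat.card ↥(E ⊓ N) = p ^ pRank p G := by
    have hcomm : ∀ a ∈ A, ∀ b ∈ E ⊓ N, Commute a b :=
      fun a ha b hb => hE.1 a (hAE ha) b hb.1
    rw [← Subgroup.card_sup_of_disjoint_of_commute hcomm hd, hsup, hk]
  obtain ⟨j, -, hj⟩ := (Nat.dvd_prime_pow hp).1 (Dvd.intro _ hcard)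
  obtain ⟨i, -, hi⟩ := (Nat.dvd_prime_pow hp).1 (Dvd.intro_left _ hcard)
  have hC : E ⊓ N ≤ N ⊓ Subgroup.centralizer (A : Set G) := fun x hx =>
    ⟨hx.2, Subgroup.mem_centralizer_iff.2 fun a ha => hE.1 a (hAE ha) x hx.1⟩
  have hrank : i ≤ pRank p ↥(N ⊓ Subgroup.centralizer (A : Set G)) :=
    (hE.mono inf_le_left).le_pRank_of_le hp hC hi
  have hij : j + i = pRank p G := by
    rw [hj, hi, ← pow_add] at hcard
    exact Nat.pow_right_injective hp.two_le hcard
  have hmem : pRank p ↥(N ⊓ Subgroup.centralizer (A : Set G)) + j ∈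
      {m : ℕ | ∃ A : Subgroup G, IsElemAbelian p A ∧ A ⊓ N = ⊥ ∧
        ∃ j : ℕ, Nat.card A = p ^ j ∧
          m = pRank p ↥(N ⊓ Subgroup.centralizer (A : Set G)) + j} :=
    ⟨A, hA, hAN, j, hj, rfl⟩
  exact le_antisymm (le_csSup_of_le ⟨_, hbound⟩ hmem (by omega)) (csSup_le ⟨_, hmem⟩ hbound)
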